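/- For all integers s ≥ 2, k ≥ 1 and n > 2^{15} · s · (log₂(sk))³, the sequence f_i = (i−1)·n^{k−1} + 5·s²·n^{k−2} (i = 1, …, s) is satisfying: whenever families F_1, …, F_s ⊆ [n]^k satisfy |F_i| > f_i for every i ∈ [s], the families contain a rainbow matching. -/

import Mathlib

open Finset in
/-- Recolouring the vertices of `T` with the colour `l`. -/
def recolor {V C : Type*} [DecidableEq V] (c : V → C) (T : Finset V) (l : C) : V → C :=
  fun v => if v ∈ T then l else c v

open Finset in
lemma sum_recolor_le {V C : Type*} [Fintype V] [DecidableEq V] [Fintype C] [DecidableEq C]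
    (T : Finset V) (l : C) (g : (V → C) → ℝ) (hg : ∀ c, 0 ≤ g c) :
    ∑ c, g (recolor c T l) ≤ (Fintype.card C : ℝ) ^ #T * ∑ c, g c := by
  have hinj : Function.Injective
      (fun c : V → C => ((recolor c T l, fun v : T => c v) : (V → C) × (T → C))) := by
    intro c c' h
    simp only [Prod.mk.injEq] at h
    funext v
    by_cases hv : v ∈ T
    · exact congrFun h.2 ⟨v, hv⟩
    · simpa [recolor, hv] using congrFun h.1 v
  calc ∑ c, g (recolor c T l)
      = ∑ p ∈ univ.image (fun c : V → C =>
          ((recolor c T l, fun v : T => c v) : (V → C) × (T → C))), g p.1 := by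
        rw [sum_image (fun a _ b _ h => hinj h)]
    _ ≤ ∑ p : (V → C) × (T → C), g p.1 :=
        sum_le_sum_of_subset_of_nonneg (subset_univ _) (fun p _ _ => hg _)
    _ = (Fintype.card C : ℝ) ^ #T * ∑ c, g c := by
        rw [Fintype.sum_prod_type]
        simp [mul_sum]

lemma one_add_sub_half_le (a b : ℕ) : 1 + (b : ℝ) - (a : ℝ) / 2 ≤ 4 ^ b / 2 ^ a := by
  rw [le_div_iff₀ (by positivity), show (4 : ℝ) = 2 ^ 2 by norm_num, ← pow_mul]
  rcases le_or_gt a (2 * b) with h | h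
  · obtain ⟨d, hd⟩ := Nat.exists_eq_add_of_le h
    have hd' : (2 : ℝ) * b = a + d := by exact_mod_cast hd
    have h1 : (d : ℝ) + 1 ≤ 2 ^ d := by exact_mod_cast Nat.lt_two_pow_self
    rw [hd, pow_add, mul_comm]
    gcongr
    have : (0 : ℝ) ≤ d := by positivity
    linarith
  · obtain ⟨d, hd⟩ := Nat.exists_eq_add_of_lt h
    have hd' : (a : ℝ) = 2 * b + d + 1 := by exact_mod_cast hd
    rw [hd, pow_add, pow_add]
    have h1 : (0 : ℝ) < 2 ^ (2 * b) := by positivity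
    have h2 : (1 + (b : ℝ) - ((2 * b + d + 1 : ℕ) : ℝ) / 2) * (2 ^ d * 2) ≤ 1 := by
      push_cast
      rcases Nat.eq_zero_or_pos d with rfl | hd
      · norm_num; linarith
      · have : (1 : ℝ) ≤ d := by exact_mod_cast hd
        have h3 : (0 : ℝ) < 2 ^ d * 2 := by positivity
        nlinarith
    nlinarith

open Finset in
/-- One round of refining fragments: exposing the colour `l` halves the average size of the
fragments of a spread family. -/
lemma exists_refinement {V C ι : Type*} [Fintype V] [DecidableEq V] [Fintype C] [DecidableEq C]
    [Fintype ι] (φ : ι → Finset V)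
    (hφ : ∀ T : Finset V, #{x | T ⊆ φ x} * (4 * Fintype.card C) ^ #T ≤ Fintype.card ι)
    (L : Finset C) (l : C) (hl : l ∉ L) (A : (V → C) → ι → Finset V)
    (hsub : ∀ c x, A c x ⊆ φ x)
    (hdep : ∀ c c', (∀ v, c v = c' v ∨ (c v ∉ L ∧ c' v ∉ L)) → A c = A c')
    (hdisj : ∀ c x, ∀ v ∈ A c x, c v ∉ L)
    (hcov : ∀ c x, ∃ y, ∀ v ∈ φ y, v ∈ A c x ∨ c v ∈ L) :
    ∃ B : (V → C) → ι → Finset V, (∀ c x, B c x ⊆ φ x) ∧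
      (∀ c c', (∀ v, c v = c' v ∨ (c v ∉ insert l L ∧ c' v ∉ insert l L)) → B c = B c') ∧
      (∀ c x, ∀ v ∈ B c x, c v ∉ insert l L) ∧
      (∀ c x, ∃ y, ∀ v ∈ φ y, v ∈ B c x ∨ c v ∈ insert l L) ∧
      2 * ∑ c, ∑ x, (#(B c x) : ℝ) ≤ ∑ c, ∑ x, (#(A c x) : ℝ) := by
  have hpick : ∀ (a : ι → Finset V) (W : Finset V) (x : ι), ∃ y,
      (a y ⊆ a x ∪ W ∧ #(a y) ≤ #(a x)) ∧
      ∀ z, a z ⊆ a x ∪ W → #(a z) ≤ #(a x) → #(a y \ W) ≤ #(a z \ W) := by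
    intro a W x
    obtain ⟨y, hy, hmin⟩ := exists_min_image
      (univ.filter fun y => a y ⊆ a x ∪ W ∧ #(a y) ≤ #(a x)) (fun y => #(a y \ W))
      ⟨x, by simp⟩
    exact ⟨y, by simpa using hy, fun z h1 h2 => hmin z (by simp [h1, h2])⟩
  choose pick hpick1 hpick2 using hpick
  have hmin : ∀ (a : ι → Finset V) (W : Finset V), ∃ D : Finset V, ∀ y, a y ⊆ W →
      #D ≤ #(a y) ∧ ∃ z, D = a z ∧ D ⊆ W := by
    intro a W
    by_cases h : ∃ y, a y ⊆ W
    · obtain ⟨y, hy⟩ := h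
      obtain ⟨z, hz, hz'⟩ := exists_min_image (univ.filter fun y => a y ⊆ W) (fun y => #(a y))
        ⟨y, by simpa using hy⟩
      exact ⟨a z, fun y hy => ⟨hz' y (by simpa using hy), z, rfl, by simpa using hz⟩⟩
    · exact ⟨∅, fun y hy => (h ⟨y, hy⟩).elim⟩
  choose core hcore using hmin
  let W : (V → C) → Finset V := fun c => {v | c v = l}
  let B : (V → C) → ι → Finset V := fun c x => A c (pick (A c) (W c) x) \ W c
  have hBA : ∀ c x, B c x ⊆ A c x := by
    intro c x v hv
    simp only [B, mem_sdiff] at hv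
    have := (hpick1 (A c) (W c) x).1 hv.1
    simp only [mem_union] at this
    exact this.resolve_right hv.2
  have hBW : ∀ c x, ∀ v ∈ B c x, c v ≠ l := by
    intro c x v hv
    simp only [B, W, mem_sdiff, mem_filter, mem_univ, true_and] at hv
    exact hv.2
  refine ⟨B, fun c x => (hBA c x).trans (hsub c x), ?_, ?_, ?_, ?_⟩
  · intro c c' h
    have h1 : A c = A c' := hdep c c' fun v => (h v).imp_right fun hv =>
      ⟨fun h' => hv.1 (mem_insert_of_mem h'), fun h' => hv.2 (mem_insert_of_mem h')⟩
    have h2 : W c = W c' := by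
      ext v
      simp only [W, mem_filter, mem_univ, true_and]
      rcases h v with h | ⟨h, h'⟩
      · rw [h]
      · simp only [mem_insert, not_or] at h h'
        exact ⟨fun e => (h.1 e).elim, fun e => (h'.1 e).elim⟩
    simp only [B, h1, h2]
  · intro c x v hv
    simp only [mem_insert, not_or]
    exact ⟨hBW c x v hv, hdisj c x v (hBA c x hv)⟩
  · intro c x
    obtain ⟨y, hy⟩ := hcov c (pick (A c) (W c) x)
    refine ⟨y, fun v hv => ?_⟩
    by_cases hvl : c v = l
    · simp [hvl]
    · rcases hy v hv with h | h
      · left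
        simp only [B, W, mem_sdiff, mem_filter, mem_univ, true_and]
        exact ⟨h, hvl⟩
      · right; simp [h]
  · let g : Finset V → (V → C) → ℝ := fun T c =>
      if T ⊆ core (A c) (W c) then 4 ^ #T / 2 ^ #(core (A c) (W c)) else 0
    have hg : ∀ T c, 0 ≤ g T c := by
      intro T c
      simp only [g]
      split_ifs <;> positivity
    have hpoint : ∀ c x, (4 : ℝ) ^ #(B c x) / 2 ^ #(A c x) ≤ g (B c x) (recolor c (B c x) l) := by
      intro c x
      set T := B c x with hT
      set y := pick (A c) (W c) x with hy
      have hA : A (recolor c T l) = A c := by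
        symm
        apply hdep
        intro v
        by_cases hv : v ∈ T
        · right
          simp only [recolor, hv, if_true]
          exact ⟨hdisj c x v (hBA c x hv), hl⟩
        · left; simp [recolor, hv]
      have hW : W (recolor c T l) = W c ∪ T := by
        ext v
        by_cases hv : v ∈ T <;> simp [W, recolor, hv]
      have hyW : A c y ⊆ W c ∪ T := by
        intro v hv
        by_cases h : v ∈ W c
        · simp [h]
        · simp only [mem_union]; right
          exact mem_sdiff.2 ⟨hv, h⟩
      obtain ⟨hle, z, hz, hzW⟩ := hcore (A c) (W c ∪ T) y hyW
      have hle' := hle.trans (hpick1 (A c) (W c) x).2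
      have hsubx : A c z ⊆ A c x ∪ W c := by
        rw [← hz]
        refine hzW.trans ?_
        rw [union_comm]
        exact union_subset_union_left (hBA c x)
      have hmin := hpick2 (A c) (W c) x z hsubx (hz ▸ hle')
      have hsubT : A c z \ W c ⊆ T := by
        intro v hv
        rw [mem_sdiff, ← hz] at hv
        exact (mem_union.1 (hzW hv.1)).resolve_left hv.2
      have hTz : T ⊆ core (A c) (W c ∪ T) := by
        rw [hz]
        exact (eq_of_subset_of_card_le hsubT hmin).symm.subset.trans sdiff_subset
      simp only [g, hA, hW, hTz, if_true]
      gcongr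
      norm_num
    have hcount : ∑ c, ∑ x, (4 : ℝ) ^ #(B c x) / 2 ^ #(A c x)
        ≤ Fintype.card (V → C) * Fintype.card ι := by
      have hN : (0 : ℝ) < Fintype.card C := by
        exact_mod_cast Fintype.card_pos_iff.2 ⟨l⟩
      calc ∑ c, ∑ x, (4 : ℝ) ^ #(B c x) / 2 ^ #(A c x)
          ≤ ∑ c, ∑ x, ∑ T, if T ⊆ φ x then g T (recolor c T l) else 0 := by
            gcongr with c _ x _
            have h0 : ∀ T ∈ (univ : Finset (Finset V)),
                0 ≤ if T ⊆ φ x then g T (recolor c T l) else 0 := by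
              intro T _
              split_ifs
              · exact hg _ _
              · exact le_rfl
            refine le_trans ?_ (single_le_sum h0 (mem_univ (B c x)))
            rw [if_pos ((hBA c x).trans (hsub c x))]
            exact hpoint c x
        _ = ∑ T, ∑ x, if T ⊆ φ x then ∑ c, g T (recolor c T l) else 0 := by
            rw [sum_comm]
            simp_rw [sum_comm (s := (univ : Finset (V → C)))]
            rw [sum_comm]
            refine sum_congr rfl fun T _ => sum_congr rfl fun x _ => ?_
            split_ifs <;> simp
        _ = ∑ T : Finset V, (#{x | T ⊆ φ x} : ℝ) * ∑ c, g T (recolor c T l) := by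
            refine sum_congr rfl fun T _ => ?_
            rw [← sum_filter, sum_const, nsmul_eq_mul]
        _ ≤ ∑ T : Finset V, Fintype.card ι * ∑ c, g T c / 4 ^ #T := by
            refine sum_le_sum fun T _ => ?_
            have h1 := sum_recolor_le T l (g T) (hg T)
            have h2 : (#{x | T ⊆ φ x} : ℝ) * (4 * Fintype.card C) ^ #T ≤ Fintype.card ι := by
              exact_mod_cast hφ T
            rw [← sum_div]
            have h3 : 0 ≤ ∑ c, g T c := sum_nonneg fun c _ => hg T c
            calc (#{x | T ⊆ φ x} : ℝ) * ∑ c, g T (recolor c T l)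
                ≤ #{x | T ⊆ φ x} * ((Fintype.card C : ℝ) ^ #T * ∑ c, g T c) := by gcongr
              _ = (#{x | T ⊆ φ x} * (4 * Fintype.card C) ^ #T) * ((∑ c, g T c) / 4 ^ #T) := by
                  rw [mul_pow]; field_simp
              _ ≤ _ := by gcongr
        _ = Fintype.card ι * ∑ c, ∑ T : Finset V, g T c / 4 ^ #T := by
            rw [← mul_sum, sum_comm]
        _ ≤ Fintype.card ι * ∑ c : V → C, (1 : ℝ) := by
            gcongr with c _
            have : ∀ T : Finset V, g T c / 4 ^ #T =
                if T ⊆ core (A c) (W c) then ((2 : ℝ) ^ #(core (A c) (W c)))⁻¹ else 0 := by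
              intro T
              simp only [g]
              split_ifs
              · field_simp
              · simp
            simp_rw [this]
            rw [← sum_filter, sum_const]
            have h4 : (univ.filter fun T => T ⊆ core (A c) (W c)) =
                (core (A c) (W c)).powerset := by
              ext T; simp
            rw [h4, card_powerset]
            simp
        _ = _ := by simp [mul_comm]
    have hjensen : ∑ c, ∑ x, (1 + (#(B c x) : ℝ) - (#(A c x) : ℝ) / 2) ≤
        ∑ c, ∑ x, (4 : ℝ) ^ #(B c x) / 2 ^ #(A c x) := by
      gcongr with c _ x _
      exact one_add_sub_half_le _ _
    have hsplit : ∑ c, ∑ x, (1 + (#(B c x) : ℝ) - (#(A c x) : ℝ) / 2) =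
        (Fintype.card (V → C) * Fintype.card ι : ℝ) + ∑ c, ∑ x, (#(B c x) : ℝ)
          - (∑ c, ∑ x, (#(A c x) : ℝ)) / 2 := by
      simp only [sum_sub_distrib, sum_add_distrib, sum_div]
      simp
    linarith

open Finset in
/-- In a random colouring, few colourings have no member of a spread family all of whose
vertices receive colours from `L`. -/
lemma card_bad_colorings_le {V C ι : Type*} [Fintype V] [DecidableEq V] [Fintype C]
    [DecidableEq C] [Fintype ι] [Nonempty ι] (φ : ι → Finset V)
    (hφ : ∀ T : Finset V, #{x | T ⊆ φ x} * (4 * Fintype.card C) ^ #T ≤ Fintype.card ι)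
    (K : ℕ) (hK : ∀ x, #(φ x) ≤ K) (L : Finset C) :
    #{c : V → C | ∀ y, ∃ v ∈ φ y, c v ∉ L} * 2 ^ #L ≤ K * Fintype.card (V → C) := by
  have key : ∃ A : (V → C) → ι → Finset V, (∀ c x, A c x ⊆ φ x) ∧
      (∀ c c', (∀ v, c v = c' v ∨ (c v ∉ L ∧ c' v ∉ L)) → A c = A c') ∧
      (∀ c x, ∀ v ∈ A c x, c v ∉ L) ∧
      (∀ c x, ∃ y, ∀ v ∈ φ y, v ∈ A c x ∨ c v ∈ L) ∧
      2 ^ #L * ∑ c, ∑ x, (#(A c x) : ℝ) ≤ K * Fintype.card (V → C) * Fintype.card ι := by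
    induction L using Finset.induction_on with
    | empty =>
      refine ⟨fun _ => φ, fun _ _ => Subset.rfl, fun _ _ _ => rfl, by simp,
        fun c x => ⟨x, fun v hv => Or.inl hv⟩, ?_⟩
      have h : ∑ x, (#(φ x) : ℝ) ≤ ∑ _x : ι, (K : ℝ) := by
        gcongr with x _
        exact hK x
      have h2 : ∑ _c : V → C, ∑ x, (#(φ x) : ℝ) ≤ ∑ _c : V → C, ∑ _x : ι, (K : ℝ) := by
        gcongr
      simp only [sum_const, card_univ, nsmul_eq_mul, card_empty, pow_zero, one_mul] at h2 ⊢
      linarith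
    | insert l L hl ih =>
      obtain ⟨A, h1, h2, h3, h4, h5⟩ := ih
      obtain ⟨B, g1, g2, g3, g4, g5⟩ := exists_refinement φ hφ L l hl A h1 h2 h3 h4
      refine ⟨B, g1, g2, g3, g4, le_trans ?_ h5⟩
      rw [card_insert_of_notMem hl, pow_succ, mul_assoc]
      gcongr
  obtain ⟨A, -, -, -, hcov, hsum⟩ := key
  have hι : (0 : ℝ) < Fintype.card ι := by exact_mod_cast Fintype.card_pos
  have hlow : (#{c : V → C | ∀ y, ∃ v ∈ φ y, c v ∉ L} : ℝ) * Fintype.card ι ≤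
      ∑ c, ∑ x, (#(A c x) : ℝ) := by
    calc (#{c : V → C | ∀ y, ∃ v ∈ φ y, c v ∉ L} : ℝ) * Fintype.card ι
        = ∑ c ∈ {c : V → C | ∀ y, ∃ v ∈ φ y, c v ∉ L}, ∑ _x : ι, (1 : ℝ) := by simp
      _ ≤ ∑ c ∈ {c : V → C | ∀ y, ∃ v ∈ φ y, c v ∉ L}, ∑ x, (#(A c x) : ℝ) := by
          gcongr with c hc x _
          obtain ⟨y, hy⟩ := hcov c x
          simp only [mem_filter, mem_univ, true_and] at hc
          obtain ⟨v, hv, hvL⟩ := hc y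
          exact_mod_cast card_pos.2 ⟨v, (hy v hv).resolve_right hvL⟩
      _ ≤ _ := sum_le_sum_of_subset_of_nonneg (subset_univ _)
          (fun c _ _ => sum_nonneg fun x _ => by positivity)
  have : (#{c : V → C | ∀ y, ∃ v ∈ φ y, c v ∉ L} * 2 ^ #L : ℝ) ≤ K * Fintype.card (V → C) := by
    refine le_of_mul_le_mul_right ?_ hι
    calc _ = 2 ^ #L * ((#{c : V → C | ∀ y, ∃ v ∈ φ y, c v ∉ L} : ℝ) * Fintype.card ι) := by ring
      _ ≤ 2 ^ #L * ∑ c, ∑ x, (#(A c x) : ℝ) := by gcongr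
      _ ≤ _ := hsum
  exact_mod_cast this

open Finset in
/-- Sufficiently spread families of sets contain pairwise disjoint members. -/
lemma exists_disjoint_of_spread {V : Type*} [Fintype V] [DecidableEq V] (s m K : ℕ)
    (hsm : s * K < 2 ^ m) {ι : Fin s → Type*} [∀ i, Fintype (ι i)] [∀ i, Nonempty (ι i)]
    (φ : ∀ i, ι i → Finset V) (hK : ∀ i x, #(φ i x) ≤ K)
    (hφ : ∀ i, ∀ T : Finset V, #{x | T ⊆ φ i x} * (4 * (s * m)) ^ #T ≤ Fintype.card (ι i)) :
    ∃ y : ∀ i, ι i, ∀ i j, i ≠ j → Disjoint (φ i (y i)) (φ j (y j)) := by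
  rcases Nat.eq_zero_or_pos (s * m) with h0 | hpos
  · rcases Nat.mul_eq_zero.1 h0 with rfl | rfl
    · exact ⟨fun i => i.elim0, fun i => i.elim0⟩
    · rcases Nat.mul_eq_zero.1 (Nat.lt_one_iff.1 hsm) with rfl | rfl
      · exact ⟨fun i => i.elim0, fun i => i.elim0⟩
      · refine ⟨fun i => Classical.arbitrary _, fun i j _ => ?_⟩
        have := hK i (Classical.arbitrary _)
        rw [Nat.le_zero, card_eq_zero] at this
        simp [this]
  let L : Fin s → Finset (Fin s × Fin m) := fun i => {p | p.1 = i}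
  have hL : ∀ i, #(L i) = m := by
    intro i
    have : L i = univ.image (fun t : Fin m => (i, t)) := by
      ext ⟨a, b⟩
      simp [L, eq_comm]
    rw [this, card_image_of_injective _ (fun a b h => by simpa using h)]
    simp
  have hbad : ∀ i, #{c : V → Fin s × Fin m | ∀ y, ∃ v ∈ φ i y, c v ∉ L i} * 2 ^ m ≤
      K * Fintype.card (V → Fin s × Fin m) := by
    intro i
    have := card_bad_colorings_le (C := Fin s × Fin m) (φ i) (by simpa using hφ i) K (hK i) (L i)
    rwa [hL] at this
  have hcol : 0 < Fintype.card (V → Fin s × Fin m) := by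
    have hs : 0 < s := Nat.pos_of_mul_pos_right hpos
    have hm : 0 < m := Nat.pos_of_mul_pos_left hpos
    exact Fintype.card_pos_iff.2 ⟨fun _ => (⟨0, hs⟩, ⟨0, hm⟩)⟩
  have hgood : ∃ c : V → Fin s × Fin m, ∀ i, ∃ y, ∀ v ∈ φ i y, c v ∈ L i := by
    by_contra hno
    push Not at hno
    have hcover : (univ : Finset (V → Fin s × Fin m)) ⊆
        univ.biUnion fun i => {c | ∀ y, ∃ v ∈ φ i y, c v ∉ L i} := by
      intro c _
      obtain ⟨i, hi⟩ := hno c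
      simp only [mem_biUnion, mem_univ, true_and, mem_filter]
      exact ⟨i, hi⟩
    have h1 := (card_le_card hcover).trans card_biUnion_le
    rw [card_univ] at h1
    have h2 : Fintype.card (V → Fin s × Fin m) * 2 ^ m ≤
        s * (K * Fintype.card (V → Fin s × Fin m)) := by
      calc _ ≤ (∑ i, #{c : V → Fin s × Fin m | ∀ y, ∃ v ∈ φ i y, c v ∉ L i}) * 2 ^ m := by gcongr
        _ = ∑ i, #{c : V → Fin s × Fin m | ∀ y, ∃ v ∈ φ i y, c v ∉ L i} * 2 ^ m := by
            rw [sum_mul]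
        _ ≤ ∑ _i : Fin s, K * Fintype.card (V → Fin s × Fin m) := sum_le_sum fun i _ => hbad i
        _ = _ := by simp
    have h3 : s * K * Fintype.card (V → Fin s × Fin m) <
        2 ^ m * Fintype.card (V → Fin s × Fin m) := by gcongr
    linarith
  obtain ⟨c, hc⟩ := hgood
  choose y hy using hc
  refine ⟨y, fun i j hij => disjoint_left.2 fun v hi hj => hij ?_⟩
  have h1 := hy i v hi
  have h2 := hy j v hj
  simp only [L, mem_filter, mem_univ, true_and] at h1 h2
  exact h1.symm.trans h2

open Finset in
/-- The set of pairs `(j, x j)` associated with a tuple `x`. -/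
def tupleGraph {k n : ℕ} (x : Fin k → Fin n) : Finset (Fin k × Fin n) := {p | x p.1 = p.2}

lemma mem_tupleGraph {k n : ℕ} (x : Fin k → Fin n) (p : Fin k × Fin n) :
    p ∈ tupleGraph x ↔ x p.1 = p.2 := by
  simp [tupleGraph]

open Finset in
lemma card_tupleGraph_le {k n : ℕ} (x : Fin k → Fin n) : #(tupleGraph x) ≤ k := by
  have h : tupleGraph x ⊆ univ.image (fun j => (j, x j)) := by
    rintro ⟨j, a⟩ h
    rw [mem_tupleGraph] at h
    simp only [mem_image, mem_univ, true_and]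
    exact ⟨j, Prod.ext rfl h⟩
  exact (card_le_card h).trans (card_image_le.trans (by simp))

open Finset in
lemma card_superset_mul_pow_le {k n : ℕ} (T : Finset (Fin k × Fin n)) :
    #{x : Fin k → Fin n | T ⊆ tupleGraph x} * n ^ #T ≤ n ^ k := by
  induction T using Finset.induction_on with
  | empty => simp
  | insert v T hv ih =>
    refine le_trans ?_ ih
    rw [card_insert_of_notMem hv, pow_succ', ← mul_assoc]
    gcongr
    calc #{x : Fin k → Fin n | insert v T ⊆ tupleGraph x} * n
        = #(({x | insert v T ⊆ tupleGraph x} : Finset (Fin k → Fin n)) ×ˢ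
            (univ : Finset (Fin n))) := by
          simp [card_product]
      _ ≤ _ := by
          refine card_le_card_of_injOn (fun p => Function.update p.1 v.1 p.2) ?_ ?_
          · rintro ⟨x, b⟩ h
            simp only [coe_product, coe_filter, mem_univ, true_and, Set.mem_prod,
              Set.mem_ofPred_eq, insert_subset_iff] at h ⊢
            intro p hp
            have hxp := (mem_tupleGraph _ _).1 (h.1.2 hp)
            have hxv := (mem_tupleGraph _ _).1 h.1.1
            have hne : p.1 ≠ v.1 := by
              intro e
              apply hv
              have : p = v := Prod.ext e (by rw [← hxp, ← hxv, e])
              rwa [← this]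
            rw [mem_tupleGraph, Function.update_of_ne hne, hxp]
          · rintro ⟨x, b⟩ hx ⟨x', b'⟩ hx' h
            simp only [coe_product, coe_filter, mem_univ, true_and, Set.mem_prod,
              Set.mem_ofPred_eq, insert_subset_iff, mem_tupleGraph] at hx hx' h
            have hb : b = b' := by simpa using congrFun h v.1
            refine Prod.ext ?_ hb
            funext j
            by_cases hj : j = v.1
            · subst hj
              exact hx.1.1.trans hx'.1.1.symm
            · simpa [Function.update_of_ne hj] using congrFun h j

open Finset in
/-- `X` has at most two elements and some nonempty subfamily of `F`, all of whose members contain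
`X`, is `r`-spread above `X`. -/
def IsSpreadKernel {k n : ℕ} (r : ℕ) (F : Finset (Fin k → Fin n)) (X : Finset (Fin k × Fin n)) :
    Prop :=
  #X ≤ 2 ∧ ∃ G ⊆ F, G.Nonempty ∧ (∀ x ∈ G, X ⊆ tupleGraph x) ∧
    ∀ Y, X ⊆ Y → #{x ∈ G | Y ⊆ tupleGraph x} * r ^ #Y ≤ #G * r ^ #X

open Finset Classical in
/-- Few members of a family contain no spread kernel. -/
lemma card_residual_le {k n r : ℕ} (hr : 0 < r) (hrn : r ≤ n) (F : Finset (Fin k → Fin n)) :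
    #{x ∈ F | ∀ X, IsSpreadKernel r F X → ¬ X ⊆ tupleGraph x} * n ^ 3 ≤ r ^ 3 * n ^ k := by
  by_contra! hlt
  set G := {x ∈ F | ∀ X, IsSpreadKernel r F X → ¬ X ⊆ tupleGraph x} with hG
  obtain ⟨X, -, hX⟩ := exists_max_image (univ : Finset (Finset (Fin k × Fin n)))
    (fun X => #{x ∈ G | X ⊆ tupleGraph x} * r ^ #X) ⟨∅, mem_univ _⟩
  have h0 : #G ≤ #{x ∈ G | X ⊆ tupleGraph x} * r ^ #X := by simpa using hX ∅ (mem_univ _)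
  have hn : 0 < n := hr.trans_le hrn
  have hXn : #{x ∈ G | X ⊆ tupleGraph x} * n ^ #X ≤ n ^ k := by
    refine le_trans ?_ (card_superset_mul_pow_le X)
    gcongr
    exact subset_univ _
  have hcard : #X ≤ 2 := by
    by_contra! h3
    obtain ⟨d, hd⟩ := Nat.exists_eq_add_of_le (show 3 ≤ #X from h3)
    have : #G * n ^ 3 ≤ r ^ 3 * n ^ k := by
      calc #G * n ^ 3 ≤ (#{x ∈ G | X ⊆ tupleGraph x} * r ^ #X) * n ^ 3 := by gcongr
        _ = r ^ 3 * (#{x ∈ G | X ⊆ tupleGraph x} * (n ^ 3 * r ^ d)) := by rw [hd]; ring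
        _ ≤ r ^ 3 * (#{x ∈ G | X ⊆ tupleGraph x} * (n ^ 3 * n ^ d)) := by gcongr
        _ = r ^ 3 * (#{x ∈ G | X ⊆ tupleGraph x} * n ^ #X) := by rw [hd]; ring
        _ ≤ _ := by gcongr
    omega
  have hGpos : 0 < #G := by
    by_contra! h
    have : #G = 0 := by omega
    rw [this] at hlt
    simp at hlt
  have hne : ({x ∈ G | X ⊆ tupleGraph x}).Nonempty := by
    rw [← card_pos]
    exact Nat.pos_of_mul_pos_right (hGpos.trans_le h0)
  have hker : IsSpreadKernel r F X := by
    refine ⟨hcard, {x ∈ G | X ⊆ tupleGraph x}, (filter_subset _ _).trans (filter_subset _ _), hne,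
      fun x hx => (mem_filter.1 hx).2, fun Y _ => le_trans ?_ (hX Y (mem_univ _))⟩
    gcongr
    exact filter_subset _ _
  obtain ⟨x, hx⟩ := hne
  rw [mem_filter, hG, mem_filter] at hx
  exact hx.1.2 X hker hx.2

open Finset in
/-- Pairwise disjoint spread kernels extend to a rainbow matching. -/
lemma exists_matching_of_kernels {s k n m : ℕ} (hs : 0 < s) (hm : 0 < m) (hsm : s * k < 2 ^ m)
    (F : Fin s → Finset (Fin k → Fin n)) (X : Fin s → Finset (Fin k × Fin n))
    (hX : ∀ i, IsSpreadKernel (8 * (s * m)) (F i) (X i))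
    (hdisj : ∀ i j, i ≠ j → Disjoint (X i) (X j)) :
    ∃ g : Fin s → (Fin k → Fin n), (∀ i, g i ∈ F i) ∧
      ∀ i i', i ≠ i' → ∀ j, g i j ≠ g i' j := by
  choose hX2 G hGF hGne hGX hGs using hX
  let D : Fin s → Finset (Fin k × Fin n) := fun i => (univ.erase i).biUnion X
  have hD : ∀ i, #(D i) ≤ 2 * s := by
    intro i
    refine (card_biUnion_le_card_mul _ _ 2 fun j _ => hX2 j).trans ?_
    rw [card_erase_of_mem (mem_univ _), card_univ, Fintype.card_fin]
    omega
  have hDX : ∀ i, ∀ v ∈ D i, v ∉ X i := by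
    intro i v hv hvi
    simp only [D, mem_biUnion, mem_erase, mem_univ, and_true] at hv
    obtain ⟨j, hj, hvj⟩ := hv
    exact disjoint_left.1 (hdisj j i hj) hvj hvi
  let H : Fin s → Finset (Fin k → Fin n) := fun i => {x ∈ G i | Disjoint (D i) (tupleGraph x)}
  have hH : ∀ i, #(G i) ≤ 2 * #(H i) := by
    intro i
    have hcov : G i ⊆ H i ∪ (D i).biUnion fun v => {x ∈ G i | insert v (X i) ⊆ tupleGraph x} := by
      intro x hx
      by_cases h : Disjoint (D i) (tupleGraph x)
      · exact mem_union_left _ (mem_filter.2 ⟨hx, h⟩)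
      · obtain ⟨v, hv, hvx⟩ := not_disjoint_iff.1 h
        refine mem_union_right _ (mem_biUnion.2 ⟨v, hv, mem_filter.2 ⟨hx, ?_⟩⟩)
        exact insert_subset hvx (hGX i x hx)
    have hv : ∀ v ∈ D i,
        #{x ∈ G i | insert v (X i) ⊆ tupleGraph x} * (8 * (s * m)) ≤ #(G i) := by
      intro v hv
      have h := hGs i (insert v (X i)) (subset_insert _ _)
      rw [card_insert_of_notMem (hDX i v hv), pow_succ', ← mul_assoc] at h
      exact Nat.le_of_mul_le_mul_right h (by positivity)
    have h1 : (#(G i) - #(H i)) * (8 * (s * m)) ≤ 2 * s * #(G i) := by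
      calc (#(G i) - #(H i)) * (8 * (s * m))
          ≤ (∑ v ∈ D i, #{x ∈ G i | insert v (X i) ⊆ tupleGraph x}) * (8 * (s * m)) := by
            gcongr
            have := (card_le_card hcov).trans ((card_union_le _ _).trans
              (Nat.add_le_add_left card_biUnion_le _))
            omega
        _ = ∑ v ∈ D i, #{x ∈ G i | insert v (X i) ⊆ tupleGraph x} * (8 * (s * m)) := by
            rw [sum_mul]
        _ ≤ ∑ _v ∈ D i, #(G i) := sum_le_sum hv
        _ = #(D i) * #(G i) := by simp
        _ ≤ 2 * s * #(G i) := by gcongr; exact hD i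
    have h2 : (#(G i) - #(H i)) * (8 * s) ≤ 2 * s * #(G i) := by
      refine le_trans ?_ h1
      gcongr
      exact Nat.le_mul_of_pos_right _ hm
    have h3 : (#(G i) - #(H i)) * 4 ≤ #(G i) := by
      refine le_of_mul_le_mul_left (a := 2 * s) ?_ (by positivity)
      linarith
    omega
  have hHne : ∀ i, Nonempty (H i) := by
    intro i
    rw [nonempty_coe_sort, ← card_pos]
    have := card_pos.2 (hGne i)
    have := hH i
    omega
  let φ : ∀ i, H i → Finset (Fin k × Fin n) := fun i x => tupleGraph x.1 \ X i
  obtain ⟨y, hy⟩ := exists_disjoint_of_spread s m k hsm φ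
    (fun i x => (card_le_card sdiff_subset).trans (card_tupleGraph_le _)) (by
      intro i T
      rw [Fintype.card_coe]
      have hsubtype : #{x : H i | T ⊆ φ i x} ≤ #{x ∈ H i | T ⊆ tupleGraph x \ X i} := by
        refine card_le_card_of_injOn (fun x => x.1) ?_ (fun a _ b _ h => Subtype.ext h)
        intro x hx
        simpa [φ] using hx
      by_cases hT : Disjoint (X i) T
      · rcases T.eq_empty_or_nonempty with rfl | hTne
        · simp
        · have h := hGs i (X i ∪ T) subset_union_left
          rw [card_union_of_disjoint hT, pow_add, mul_comm ((8 * (s * m)) ^ #(X i)),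
            ← mul_assoc] at h
          have h' := Nat.le_of_mul_le_mul_right h (by positivity)
          have hle : #{x ∈ H i | T ⊆ tupleGraph x \ X i} ≤
              #{x ∈ G i | X i ∪ T ⊆ tupleGraph x} := by
            refine card_le_card fun x hx => ?_
            simp only [H, mem_filter] at hx ⊢
            exact ⟨hx.1.1, union_subset (hGX i x hx.1.1) (hx.2.trans sdiff_subset)⟩
          have h2 : 2 ≤ 2 ^ #T := Nat.le_self_pow (card_pos.2 hTne).ne' 2
          refine le_of_mul_le_mul_left (a := 2) ?_ two_pos
          calc 2 * (#{x : H i | T ⊆ φ i x} * (4 * (s * m)) ^ #T)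
              ≤ 2 ^ #T * (#{x ∈ G i | X i ∪ T ⊆ tupleGraph x} * (4 * (s * m)) ^ #T) := by
                gcongr
                exact hsubtype.trans hle
            _ = #{x ∈ G i | X i ∪ T ⊆ tupleGraph x} * (8 * (s * m)) ^ #T := by
                rw [show 8 * (s * m) = 2 * (4 * (s * m)) by ring, mul_pow 2]
                ring
            _ ≤ #(G i) := h'
            _ ≤ 2 * #(H i) := hH i
      · have h0 : #{x ∈ H i | T ⊆ tupleGraph x \ X i} = 0 := by
          rw [card_eq_zero, filter_eq_empty_iff]
          intro x _ h
          apply hT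
          exact disjoint_of_subset_right h disjoint_sdiff
        rw [h0, Nat.le_zero] at hsubtype
        rw [hsubtype, zero_mul]
        exact Nat.zero_le _)
  have hyG : ∀ i, (y i).1 ∈ G i ∧ Disjoint (D i) (tupleGraph (y i).1) := fun i =>
    mem_filter.1 (y i).2
  refine ⟨fun i => (y i).1, fun i => hGF i (hyG i).1, fun i i' hii j hj => ?_⟩
  have h1 : (j, (y i).1 j) ∈ tupleGraph (y i).1 := (mem_tupleGraph _ _).2 rfl
  have h2 : (j, (y i).1 j) ∈ tupleGraph (y i').1 := (mem_tupleGraph _ _).2 hj.symm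
  have hnot : ∀ a b : Fin s, a ≠ b → (j, (y i).1 j) ∈ tupleGraph (y b).1 →
      (j, (y i).1 j) ∉ X a := by
    intro a b hab hb ha
    refine disjoint_left.1 (hyG b).2 ?_ hb
    exact mem_biUnion.2 ⟨a, mem_erase.2 ⟨hab, mem_univ _⟩, ha⟩
  exact disjoint_left.1 (hy i i' hii) (mem_sdiff.2 ⟨h1, hnot i i' hii h2⟩)
    (mem_sdiff.2 ⟨h2, hnot i' i hii.symm h1⟩)

open Finset Classical in
/-- If some set `D` of at most `t` vertices meets all members of `S`, then the tuples containing
members of `S` are mostly covered by the vertices `v` with the property that every set of at most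
`t` vertices avoiding `v` is disjoint from a member of `S`. -/
lemma card_covered_le {k n t : ℕ} (S : Finset (Fin k × Fin n) → Prop)
    (hS : ¬ ∀ D : Finset (Fin k × Fin n), #D ≤ t → ∃ Y, S Y ∧ Disjoint Y D) :
    #{x : Fin k → Fin n | ∃ Y, S Y ∧ Y ⊆ tupleGraph x} * n ^ 2 ≤
      (#{v : Fin k × Fin n | ∀ D, #D ≤ t → v ∉ D → ∃ Y, S Y ∧ Disjoint Y D} * n + t ^ 2) *
        n ^ k := by
  set A : Finset (Fin k × Fin n) :=
    {v | ∀ D, #D ≤ t → v ∉ D → ∃ Y, S Y ∧ Disjoint Y D} with hA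
  push Not at hS
  obtain ⟨D, hDt, hD⟩ := hS
  have hex : ∀ d, ∃ E : Finset (Fin k × Fin n), d ∉ A →
      #E ≤ t ∧ d ∉ E ∧ ∀ Y, S Y → ¬ Disjoint Y E := by
    intro d
    by_cases hd : d ∈ A
    · exact ⟨∅, fun h => (h hd).elim⟩
    · have hd' := hd
      simp only [hA, mem_filter, mem_univ, true_and] at hd'
      push Not at hd'
      obtain ⟨E, h⟩ := hd'
      exact ⟨E, fun _ => h⟩
  choose E hE using hex
  let P : Finset (Fin k × Fin n) → Finset (Fin k → Fin n) := fun T => {x | T ⊆ tupleGraph x}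
  have hcov : ({x : Fin k → Fin n | ∃ Y, S Y ∧ Y ⊆ tupleGraph x} : Finset _) ⊆
      (A.biUnion fun v => P {v}) ∪
        (D \ A).biUnion fun d => (E d).biUnion fun u => P {d, u} := by
    intro x hx
    simp only [mem_filter, mem_univ, true_and] at hx
    obtain ⟨Y, hY, hYx⟩ := hx
    obtain ⟨d, hdY, hdD⟩ := not_disjoint_iff.1 (hD Y hY)
    by_cases hdA : d ∈ A
    · refine mem_union_left _ (mem_biUnion.2 ⟨d, hdA, ?_⟩)
      simpa [P] using hYx hdY
    · obtain ⟨u, huY, huE⟩ := not_disjoint_iff.1 ((hE d hdA).2.2 Y hY)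
      refine mem_union_right _ (mem_biUnion.2 ⟨d, mem_sdiff.2 ⟨hdD, hdA⟩, mem_biUnion.2
        ⟨u, huE, ?_⟩⟩)
      simp only [P, mem_filter, mem_univ, true_and, insert_subset_iff, singleton_subset_iff]
      exact ⟨hYx hdY, hYx huY⟩
  have hA1 : #(A.biUnion fun v => P {v}) * n ^ 2 ≤ #A * n * n ^ k := by
    calc #(A.biUnion fun v => P {v}) * n ^ 2 ≤ (∑ v ∈ A, #(P {v})) * n ^ 2 := by
          gcongr; exact card_biUnion_le
      _ = ∑ v ∈ A, n * (#(P {v}) * n) := by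
          rw [sum_mul]; exact sum_congr rfl fun _ _ => by ring
      _ ≤ ∑ _v ∈ A, n * n ^ k := by
          refine sum_le_sum fun v _ => ?_
          gcongr
          simpa only [card_singleton, pow_one] using card_superset_mul_pow_le {v}
      _ = _ := by simp; ring
  have hA2 : #((D \ A).biUnion fun d => (E d).biUnion fun u => P {d, u}) * n ^ 2 ≤
      t ^ 2 * n ^ k := by
    calc #((D \ A).biUnion fun d => (E d).biUnion fun u => P {d, u}) * n ^ 2
        ≤ (∑ d ∈ D \ A, ∑ u ∈ E d, #(P {d, u})) * n ^ 2 := by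
          gcongr
          exact card_biUnion_le.trans (sum_le_sum fun _ _ => card_biUnion_le)
      _ = ∑ d ∈ D \ A, ∑ u ∈ E d, #(P {d, u}) * n ^ 2 := by
          simp_rw [sum_mul]
      _ ≤ ∑ d ∈ D \ A, ∑ _u ∈ E d, n ^ k := by
          refine sum_le_sum fun d hd => sum_le_sum fun u hu => ?_
          have hne : d ≠ u := by
            rintro rfl
            exact (hE d (mem_sdiff.1 hd).2).2.1 hu
          simpa [card_pair hne] using card_superset_mul_pow_le {d, u}
      _ ≤ ∑ _d ∈ D \ A, t * n ^ k := by
          refine sum_le_sum fun d hd => ?_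
          rw [sum_const, smul_eq_mul]
          gcongr
          exact (hE d (mem_sdiff.1 hd).2).1
      _ = #(D \ A) * (t * n ^ k) := by simp
      _ ≤ t * (t * n ^ k) := by
          gcongr
          exact (card_le_card sdiff_subset).trans hDt
      _ = _ := by ring
  calc _ ≤ (#(A.biUnion fun v => P {v}) +
        #((D \ A).biUnion fun d => (E d).biUnion fun u => P {d, u})) * n ^ 2 := by
        gcongr
        exact (card_le_card hcov).trans (card_union_le _ _)
    _ ≤ #A * n * n ^ k + t ^ 2 * n ^ k := by
        rw [add_mul]; gcongr
    _ = _ := by ring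

open Finset in
/-- Sets `X₀ i` that are pairwise disjoint can be replaced one after another by pairwise disjoint
members of the families `S i`. -/
lemma exists_disjoint_of_replace {V : Type*} [DecidableEq V] {s : ℕ}
    (S : Fin s → Finset V → Prop) (hS : ∀ i Y, S i Y → #Y ≤ 2) (X₀ : Fin s → Finset V)
    (hX₀ : ∀ i, #(X₀ i) ≤ 2) (hdisj : ∀ i j, i ≠ j → Disjoint (X₀ i) (X₀ j))
    (hrep : ∀ i, ∀ D : Finset V, #D ≤ 2 * (s - 1) → Disjoint (X₀ i) D →
      ∃ Y, S i Y ∧ Disjoint Y D) :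
    ∃ X : Fin s → Finset V, (∀ i, S i (X i)) ∧ ∀ i j, i ≠ j → Disjoint (X i) (X j) := by
  have key : ∀ P : Finset (Fin s), ∃ X : Fin s → Finset V, (∀ i ∈ P, S i (X i)) ∧
      (∀ i, #(X i) ≤ 2) ∧ (∀ i j, i ≠ j → Disjoint (X i) (X j)) ∧ ∀ i ∉ P, X i = X₀ i := by
    intro P
    induction P using Finset.induction_on with
    | empty => exact ⟨X₀, by simp, hX₀, hdisj, fun _ _ => rfl⟩
    | insert i P hi ih =>
      obtain ⟨X, h1, h2, h3, h4⟩ := ih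
      obtain ⟨Y, hY, hYD⟩ := hrep i ((univ.erase i).biUnion X) (by
        refine (card_biUnion_le_card_mul _ _ 2 fun j _ => h2 j).trans ?_
        rw [card_erase_of_mem (mem_univ _), card_univ, Fintype.card_fin, mul_comm]) (by
        rw [disjoint_biUnion_right, ← h4 i hi]
        intro j hj
        exact h3 i j (mem_erase.1 hj).1.symm)
      have hYj : ∀ j, j ≠ i → Disjoint Y (X j) := fun j hj =>
        (disjoint_biUnion_right _ _ _).1 hYD j (mem_erase.2 ⟨hj, mem_univ _⟩)
      refine ⟨Function.update X i Y, ?_, ?_, ?_, ?_⟩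
      · intro j hj
        by_cases h : j = i
        · subst h; simpa using hY
        · rw [Function.update_of_ne h]
          exact h1 j ((mem_insert.1 hj).resolve_left h)
      · intro j
        by_cases h : j = i
        · subst h; simpa using hS _ _ hY
        · rw [Function.update_of_ne h]
          exact h2 j
      · intro a b hab
        by_cases ha : a = i
        · subst ha
          rw [Function.update_self, Function.update_of_ne hab.symm]
          exact hYj b hab.symm
        · rw [Function.update_of_ne ha]
          by_cases hb : b = i
          · subst hb
            rw [Function.update_self]
            exact (hYj a hab).symm
          · rw [Function.update_of_ne hb]
            exact h3 a b hab
      · intro j hj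
        rw [mem_insert, not_or] at hj
        rw [Function.update_of_ne hj.1, h4 j hj.2]
  obtain ⟨X, h1, -, h3, -⟩ := key univ
  exact ⟨X, fun i => h1 i (mem_univ i), h3⟩

open Finset Classical in
/-- Hall-type criterion: families of sets of size at most two, each of which either cannot be
blocked by few vertices or has enough vertices extendable to a member avoiding few given vertices,
contain pairwise disjoint members. -/
lemma exists_disjoint_of_card {V : Type*} [Fintype V] {s : ℕ}
    (S : Fin s → Finset V → Prop) (hS : ∀ i Y, S i Y → #Y ≤ 2)
    (h : ∀ i, (¬ ∀ D : Finset V, #D ≤ 2 * (s - 1) → ∃ Y, S i Y ∧ Disjoint Y D) →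
      (i : ℕ) < #{v : V | ∀ D : Finset V, #D ≤ 2 * (s - 1) → v ∉ D →
        ∃ Y, S i Y ∧ Disjoint Y D}) :
    ∃ X : Fin s → Finset V, (∀ i, S i (X i)) ∧ ∀ i j, i ≠ j → Disjoint (X i) (X j) := by
  let free : Fin s → Prop := fun i =>
    ∀ D : Finset V, #D ≤ 2 * (s - 1) → ∃ Y, S i Y ∧ Disjoint Y D
  let A : Fin s → Finset V := fun i =>
    {v | ∀ D : Finset V, #D ≤ 2 * (s - 1) → v ∉ D → ∃ Y, S i Y ∧ Disjoint Y D}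
  obtain ⟨f, hf, hfA⟩ := (all_card_le_biUnion_card_iff_exists_injective
    (fun i : {i // ¬ free i} => A i.1)).1 (by
      intro J
      rcases J.eq_empty_or_nonempty with rfl | hJ
      · simp
      · obtain ⟨i, hi, hmax⟩ := J.exists_max_image (fun i => (i.1 : ℕ)) hJ
        have h1 : #J ≤ i.1 + 1 := by
          have := card_le_card_of_injOn (s := J) (t := range (i.1 + 1)) (fun a => (a.1 : ℕ))
            (fun a ha => by
              have := hmax a ha
              simp only [coe_range, Set.mem_Iio]
              omega)
            (fun a _ b _ hab => Subtype.ext (Fin.ext hab))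
          simpa using this
        calc #J ≤ i.1 + 1 := h1
          _ ≤ #(A i.1) := h i.1 i.2
          _ ≤ _ := card_le_card (subset_biUnion_of_mem (fun i : {i // ¬ free i} => A i.1) hi))
  let X₀ : Fin s → Finset V := fun i => if hi : free i then ∅ else {f ⟨i, hi⟩}
  refine exists_disjoint_of_replace S hS X₀ ?_ ?_ ?_
  · intro i
    by_cases hi : free i <;> simp [X₀, hi]
  · intro i j hij
    by_cases hi : free i
    · simp [X₀, hi]
    · by_cases hj : free j
      · simp [X₀, hj]
      · simp only [X₀, hi, hj, dif_neg, not_false_eq_true, disjoint_singleton]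
        intro e
        exact hij (congrArg Subtype.val (hf e))
  · intro i D hD hdisj
    by_cases hi : free i
    · exact hi D hD
    · simp only [X₀, hi, dif_neg, not_false_eq_true, disjoint_singleton_left] at hdisj
      have := hfA ⟨i, hi⟩
      simp only [A, mem_filter, mem_univ, true_and] at this
      exact this D hD hdisj

lemma spread_parameter_le {s k n : ℕ} (hs : 2 ≤ s) (hk : 1 ≤ k)
    (hn : 2 ^ 15 * (s : ℝ) * (Real.logb 2 ((s : ℝ) * (k : ℝ))) ^ 3 < (n : ℝ)) :
    8 * (s * (Nat.log 2 (s * k) + 1)) ≤ n ∧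
      8 * (8 * (s * (Nat.log 2 (s * k) + 1))) ^ 3 ≤ s ^ 2 * n := by
  set m := Nat.log 2 (s * k) + 1 with hm
  set l := Real.logb 2 ((s : ℝ) * (k : ℝ)) with hl
  have hsk : 2 ≤ s * k := hs.trans (Nat.le_mul_of_pos_right _ hk)
  have hskR : (2 : ℝ) ≤ (s : ℝ) * k := by exact_mod_cast hsk
  have hl1 : 1 ≤ l := by
    rw [hl, Real.le_logb_iff_rpow_le (by norm_num) (by linarith)]
    simpa using hskR
  have hml : (m : ℝ) ≤ 2 * l := by
    have h := Real.natLog_le_logb (s * k) 2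
    push_cast at h
    rw [hm]
    push_cast
    linarith
  have hsR : (2 : ℝ) ≤ s := by exact_mod_cast hs
  have hl3 : l ≤ l ^ 3 := le_self_pow₀ hl1 (by norm_num)
  have hm3 : (m : ℝ) ^ 3 ≤ 8 * l ^ 3 := by
    calc (m : ℝ) ^ 3 ≤ (2 * l) ^ 3 := by gcongr
      _ = _ := by ring
  constructor
  · have : (8 * (s * m) : ℝ) ≤ n := by
      have h1 : (s : ℝ) * m ≤ s * (2 * l ^ 3) := by gcongr; linarith
      have h2 : 0 ≤ (s : ℝ) * l ^ 3 := by positivity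
      linarith
    exact_mod_cast this
  · have : (8 * (8 * (s * m)) ^ 3 : ℝ) ≤ s ^ 2 * n := by
      calc (8 * (8 * (s * m)) ^ 3 : ℝ) = s ^ 2 * (4096 * s * m ^ 3) := by ring
        _ ≤ s ^ 2 * (4096 * s * (8 * l ^ 3)) := by gcongr
        _ ≤ s ^ 2 * n := by gcongr; linarith
    exact_mod_cast this

open Finset Classical in
/-- A large family whose spread kernels are blocked by few vertices has more than `i` vertices
that extend to kernels avoiding any few given vertices. -/
lemma lt_card_extendable {s k n r i : ℕ} (hr : 0 < r) (hrn : r ≤ n)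
    (hr3 : 8 * r ^ 3 ≤ s ^ 2 * n) (F : Finset (Fin k → Fin n))
    (hF : (i * n + 5 * s ^ 2) * n ^ k < #F * n ^ 2)
    (hblock : ¬ ∀ D : Finset (Fin k × Fin n), #D ≤ 2 * (s - 1) →
      ∃ Y, IsSpreadKernel r F Y ∧ Disjoint Y D) :
    i < #{v : Fin k × Fin n | ∀ D, #D ≤ 2 * (s - 1) → v ∉ D →
      ∃ Y, IsSpreadKernel r F Y ∧ Disjoint Y D} := by
  have h1 := card_covered_le _ hblock
  have h2 := card_residual_le hr hrn F
  have h3 : #F ≤ #{x ∈ F | ∀ X, IsSpreadKernel r F X → ¬ X ⊆ tupleGraph x} +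
      #{x : Fin k → Fin n | ∃ Y, IsSpreadKernel r F Y ∧ Y ⊆ tupleGraph x} := by
    refine le_trans (card_le_card fun x hx => ?_) (card_union_le _ _)
    by_cases h : ∃ Y, IsSpreadKernel r F Y ∧ Y ⊆ tupleGraph x
    · exact mem_union_right _ (mem_filter.2 ⟨mem_univ _, h⟩)
    · push Not at h
      exact mem_union_left _ (mem_filter.2 ⟨hx, h⟩)
  generalize #{v : Fin k × Fin n | ∀ D, #D ≤ 2 * (s - 1) → v ∉ D →
    ∃ Y, IsSpreadKernel r F Y ∧ Disjoint Y D} = a at h1 ⊢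
  generalize #{x ∈ F | ∀ X, IsSpreadKernel r F X → ¬ X ⊆ tupleGraph x} = R at h2 h3
  generalize #{x : Fin k → Fin n | ∃ Y, IsSpreadKernel r F Y ∧ Y ⊆ tupleGraph x} = Q at h1 h3
  have hn : 0 < n := hr.trans_le hrn
  have h4 : i * n ^ 2 + 5 * s ^ 2 * n < r ^ 3 + (a * n + (2 * (s - 1)) ^ 2) * n := by
    refine lt_of_mul_lt_mul_right (a := n ^ k) ?_ (Nat.zero_le _)
    calc (i * n ^ 2 + 5 * s ^ 2 * n) * n ^ k = (i * n + 5 * s ^ 2) * n ^ k * n := by ring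
      _ < #F * n ^ 2 * n := by gcongr
      _ ≤ (R + Q) * n ^ 2 * n := by gcongr
      _ = R * n ^ 3 + Q * n ^ 2 * n := by ring
      _ ≤ r ^ 3 * n ^ k + (a * n + (2 * (s - 1)) ^ 2) * n ^ k * n := by gcongr
      _ = _ := by ring
  have h5 : (2 * (s - 1)) ^ 2 * n ≤ 4 * (s ^ 2 * n) := by
    calc (2 * (s - 1)) ^ 2 * n ≤ (2 * s) ^ 2 * n := by gcongr; omega
      _ = _ := by ring
  have h6 : i * n ^ 2 < a * n ^ 2 := by
    rw [add_mul, mul_assoc 5, mul_assoc a, ← sq] at h4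
    omega
  exact lt_of_mul_lt_mul_right h6 (Nat.zero_le _)

lemma card_lower_bound_of_zpow {i s k n c : ℕ} (hn : 0 < n)
    (h : (i : ℝ) * (n : ℝ) ^ ((k : ℤ) - 1) + 5 * (s : ℝ) ^ 2 * (n : ℝ) ^ ((k : ℤ) - 2) < (c : ℝ)) :
    (i * n + 5 * s ^ 2) * n ^ k < c * n ^ 2 := by
  have h := mul_lt_mul_of_pos_right h (show (0 : ℝ) < (n : ℝ) ^ 2 by positivity)
  have hnR : (n : ℝ) ≠ 0 := by exact_mod_cast hn.ne'
  have e1 : (n : ℝ) ^ ((k : ℤ) - 1) = n ^ k / n := by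
    rw [zpow_sub_one₀ hnR, zpow_natCast, div_eq_mul_inv]
  have e2 : (n : ℝ) ^ ((k : ℤ) - 2) = n ^ k / n ^ 2 := by
    rw [zpow_sub₀ hnR, zpow_natCast]; norm_cast
  have e3 : ((i : ℝ) * ((n : ℝ) ^ k / n) + 5 * (s : ℝ) ^ 2 * (n ^ k / n ^ 2)) * n ^ 2 =
      (i * n + 5 * s ^ 2) * n ^ k := by field_simp
  rw [e1, e2, e3] at h
  exact_mod_cast h

lemma exists_matching_of_card {s k n m : ℕ} (hs : 0 < s) (hm : 0 < m) (hsm : s * k < 2 ^ m)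
    (hrn : 8 * (s * m) ≤ n) (hr3 : 8 * (8 * (s * m)) ^ 3 ≤ s ^ 2 * n)
    (F : Fin s → Finset (Fin k → Fin n))
    (hF : ∀ i : Fin s, ((i : ℕ) * n + 5 * s ^ 2) * n ^ k < (F i).card * n ^ 2) :
    ∃ g : Fin s → (Fin k → Fin n), (∀ i, g i ∈ F i) ∧
      ∀ i i', i ≠ i' → ∀ j, g i j ≠ g i' j := by
  have hr : 0 < 8 * (s * m) := by positivity
  obtain ⟨X, hX, hXd⟩ := exists_disjoint_of_card (fun i => IsSpreadKernel (8 * (s * m)) (F i))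
    (fun i Y h => h.1) (fun i hi => by convert lt_card_extendable hr hrn hr3 (F i) (hF i) hi)
  exact exists_matching_of_kernels hs hm hsm F X hX hXd

/-- For `n > 2^{15} s (log₂(sk))³`, the sequence `f_i = (i-1)n^{k-1} + 5s²n^{k-2}`
is satisfying. -/
theorem stmt8 (s k n : ℕ) (hs : 2 ≤ s) (hk : 1 ≤ k)
    (hn : 2 ^ 15 * (s : ℝ) * (Real.logb 2 ((s : ℝ) * (k : ℝ))) ^ 3 < (n : ℝ))
    (F : Fin s → Finset (Fin k → Fin n))
    (hF : ∀ i : Fin s,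
      ((i : ℕ) : ℝ) * (n : ℝ) ^ ((k : ℤ) - 1) +
        5 * (s : ℝ) ^ 2 * (n : ℝ) ^ ((k : ℤ) - 2) < ((F i).card : ℝ)) :
    ∃ g : Fin s → (Fin k → Fin n), (∀ i, g i ∈ F i) ∧
      ∀ i i', i ≠ i' → ∀ j, g i j ≠ g i' j := by
  obtain ⟨hrn, hr3⟩ := spread_parameter_le hs hk hn
  have hm : 0 < Nat.log 2 (s * k) + 1 := Nat.succ_pos _
  have hn0 : 0 < n := lt_of_lt_of_le (by positivity) hrn
  exact exists_matching_of_card (by omega) hm (Nat.lt_pow_succ_log_self (by norm_num) _) hrn hr3 F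
    fun i => card_lower_bound_of_zpow hn0 (hF i)
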